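/- arXiv:2602.17879 — 2 statements merged into one kernel-verified Lean document; each statement's English description precedes it below -/
import Mathlib

section
/- Let U be a Polish space, m a Borel probability measure on U, and 𝒰 the completion of the Borel σ-algebra ℬ(U) with respect to m. Let S₁ := C([0,T]; ℝⁿ) × C([0,T]; ℝˡ) × L²([0,T]; ℝ^{l×d}) × L²([0,T]; ℝᵏ) with its Borel σ-algebra, and let (ℙᵘ)_{u∈U} be a Markov kernel from (U, 𝒰) to S₁. Let φ : U × [0,T] × ℝⁿ × ℝˡ × ℝ^{l×d} × ℝᵏ → [0,∞) be Borel measurable. Then the map (t, u) ↦ ∫_{S₁} φ(u, t, x(t), y(t), z̄(t), λ̄(t)) dℙᵘ(x, y, [z], [λ]) is measurable with respect to the product of the Lebesgue σ-algebra on [0,T] and 𝒰. -/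
/-!
STATEMENT 3 (joint measurability): If `(ℙᵘ)` is a Markov kernel from `(U, 𝒰)` (the completion
of the Borel σ-algebra w.r.t. m) to `S₁`, and `φ ≥ 0` is Borel, then
`(t, u) ↦ ∫_{S₁} φ(u, t, x(t), y(t), z̄(t), λ̄(t)) dℙᵘ` is `Leb([0,T]) ⊗ 𝒰`-measurable.
-/

open MeasureTheory Set Filter

/-- `avg μ f ε t = ε⁻¹ ∫_{max(t−ε,0)}^{t} f(s) dμ(s)`. -/
noncomputable def avg {ι : Type*} [Fintype ι] (μ : Measure ℝ)
    (f : ℝ → EuclideanSpace ℝ ι) (ε t : ℝ) : EuclideanSpace ℝ ι :=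
  ε⁻¹ • ∫ s in Set.Ioc (max (t - ε) 0) t, f s ∂μ

/-- The componentwise liminf (in the extended reals) of the averages as ε ↓ 0. -/
noncomputable def hatComp {ι : Type*} [Fintype ι] (μ : Measure ℝ)
    (f : ℝ → EuclideanSpace ℝ ι) (t : ℝ) (i : ι) : EReal :=
  liminf (fun ε : ℝ => ((avg μ f ε t i : ℝ) : EReal)) (nhdsWithin 0 (Set.Ioi 0))

open scoped Classical in
/-- The precise representative `f̄`. -/
noncomputable def precise {ι : Type*} [Fintype ι] (μ : Measure ℝ)
    (f : ℝ → EuclideanSpace ℝ ι) (t : ℝ) : EuclideanSpace ℝ ι :=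
  if ∀ i, hatComp μ f t i ≠ ⊤ ∧ hatComp μ f t i ≠ ⊥ then
    (WithLp.equiv 2 (ι → ℝ)).symm fun i => (hatComp μ f t i).toReal
  else 0

/-- The completion of a σ-algebra with respect to a measure μ: the σ-algebra of
μ-null-measurable sets. -/
def completionSigma {α : Type*} [MeasurableSpace α] (μ : Measure α) : MeasurableSpace α where
  MeasurableSet' s := NullMeasurableSet s μ
  measurableSet_empty := MeasurableSet.empty.nullMeasurableSet
  measurableSet_compl _ h := h.compl
  measurableSet_iUnion _ h := NullMeasurableSet.iUnion h

/-- Spaces of continuous functions carry the Borel σ-algebra of their topology. -/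
noncomputable instance {X Y : Type*} [TopologicalSpace X] [TopologicalSpace Y] :
    MeasurableSpace (ContinuousMap X Y) := borel _

instance {X Y : Type*} [TopologicalSpace X] [TopologicalSpace Y] :
    BorelSpace (ContinuousMap X Y) := ⟨rfl⟩

/-- `L²` spaces carry the Borel σ-algebra of their norm topology. -/
noncomputable instance {α : Type*} [MeasurableSpace α] {μ : Measure α}
    {E : Type*} [NormedAddCommGroup E] {p : ENNReal} [Fact (1 ≤ p)] :
    MeasurableSpace (Lp E p μ) := borel _

instance {α : Type*} [MeasurableSpace α] {μ : Measure α}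
    {E : Type*} [NormedAddCommGroup E] {p : ENNReal} [Fact (1 ≤ p)] :
    BorelSpace (Lp E p μ) := ⟨rfl⟩

/-- The state space `ℝⁿ × ℝˡ × ℝ^{l×d} × ℝᵏ`. -/
abbrev StateSpace (n l d k : ℕ) : Type :=
  EuclideanSpace ℝ (Fin n) × EuclideanSpace ℝ (Fin l) ×
    EuclideanSpace ℝ (Fin l × Fin d) × EuclideanSpace ℝ (Fin k)

/-- The path space `S₁ = C([0,T];ℝⁿ) × C([0,T];ℝˡ) × L²([0,T];ℝ^{l×d}) × L²([0,T];ℝᵏ)`. -/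
abbrev PathSpace (T : ℝ) (n l d k : ℕ) : Type :=
  ContinuousMap (Set.Icc (0:ℝ) T) (EuclideanSpace ℝ (Fin n)) ×
    ContinuousMap (Set.Icc (0:ℝ) T) (EuclideanSpace ℝ (Fin l)) ×
    Lp (EuclideanSpace ℝ (Fin l × Fin d)) 2 (volume.restrict (Set.Icc (0:ℝ) T)) ×
    Lp (EuclideanSpace ℝ (Fin k)) 2 (volume.restrict (Set.Icc (0:ℝ) T))

/-- The canonical process `V_s(x, y, [z], [λ]) = (x(s), y(s), z̄(s), λ̄(s))`. -/
noncomputable def V (T : ℝ) (n l d k : ℕ) (s : Set.Icc (0:ℝ) T)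
    (ω : PathSpace T n l d k) : StateSpace n l d k :=
  (ω.1 s, ω.2.1 s,
    precise (volume.restrict (Set.Icc (0:ℝ) T)) (⇑ω.2.2.1) (s : ℝ),
    precise (volume.restrict (Set.Icc (0:ℝ) T)) (⇑ω.2.2.2) (s : ℝ))

/-- The liminf at `0⁺` of a family of measurable functions that is continuous in the parameter is
measurable: the infima over intervals may be taken over rational parameters. -/
lemma measurable_liminf_nhdsGT_zero {α : Type*} [MeasurableSpace α] {g : ℝ → α → EReal}
    (hg : ∀ ε, 0 < ε → Measurable (g ε))
    (hcont : ∀ a, ContinuousOn (fun ε => g ε a) (Ioi 0)) :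
    Measurable fun a => liminf (fun ε => g ε a) (nhdsWithin 0 (Ioi 0)) := by
  have key : ∀ a, liminf (fun ε => g ε a) (nhdsWithin 0 (Ioi 0)) =
      ⨆ n : ℕ, ⨅ q : {q : ℚ // 0 < (q : ℝ) ∧ (q : ℝ) < 1 / ((n : ℝ) + 1)}, g (q.1 : ℝ) a := by
    intro a
    rw [(nhdsGT_basis (0 : ℝ)).liminf_eq_iSup_iInf]
    apply le_antisymm
    · refine iSup₂_le fun δ hδ => ?_
      obtain ⟨n, hn⟩ := exists_nat_one_div_lt hδ
      refine le_iSup_of_le n (le_iInf fun q => ?_)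
      exact iInf₂_le (q.1 : ℝ) ⟨q.2.1, q.2.2.trans hn⟩
    · refine iSup_le fun n => ?_
      have hn : (0 : ℝ) < 1 / ((n : ℝ) + 1) := by positivity
      refine le_iSup₂_of_le (1 / ((n : ℝ) + 1)) hn (le_iInf₂ fun ε hε => ?_)
      set S : Set ℝ := Ioo 0 (1 / ((n : ℝ) + 1)) ∩ range ((↑) : ℚ → ℝ)
      have hcl : ε ∈ closure S :=
        Rat.denseRange_cast.open_subset_closure_inter isOpen_Ioo hε
      have : (nhdsWithin ε S).NeBot := mem_closure_iff_nhdsWithin_neBot.1 hcl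
      have ht : Tendsto (fun ε => g ε a) (nhdsWithin ε S) (nhds (g ε a)) :=
        ((hcont a) ε hε.1).mono fun x hx => hx.1.1
      refine ge_of_tendsto ht ?_
      filter_upwards [self_mem_nhdsWithin] with x hx
      obtain ⟨hx, q, rfl⟩ := hx
      exact iInf_le_of_le (⟨q, hx⟩ : {q : ℚ // 0 < (q : ℝ) ∧ (q : ℝ) < 1 / ((n : ℝ) + 1)}) le_rfl
  simp_rw [key]
  exact Measurable.iSup fun n => Measurable.iInf fun q => hg _ q.2.1

section Averages

variable {ι : Type*} [Fintype ι] {μ : Measure ℝ} [IsFiniteMeasure μ]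

lemma measurable_setIntegral_apply {s : Set ℝ} (hs : MeasurableSet s) (i : ι) :
    Measurable fun f : Lp (EuclideanSpace ℝ ι) 2 μ => (∫ x in s, f x ∂μ) i := by
  classical
  have h : ∀ f : Lp (EuclideanSpace ℝ ι) 2 μ, (∫ x in s, f x ∂μ) i =
      inner ℝ (indicatorConstLp 2 hs (measure_ne_top μ s) (EuclideanSpace.single i (1 : ℝ))) f := by
    intro f
    rw [L2.inner_indicatorConstLp_eq_inner_setIntegral, EuclideanSpace.inner_single_left]
    simp
  simp_rw [h]
  exact (continuous_const.inner continuous_id).measurable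

lemma Lp.intervalIntegrable (f : Lp (EuclideanSpace ℝ ι) 2 μ) (a b : ℝ) :
    IntervalIntegrable f μ a b :=
  ((Lp.memLp f).integrable one_le_two).intervalIntegrable

lemma continuous_primitive_apply [NullSingletonClass μ] (f : Lp (EuclideanSpace ℝ ι) 2 μ) (i : ι) :
    Continuous fun t => (∫ x in (0 : ℝ)..t, f x ∂μ) i :=
  (EuclideanSpace.proj (𝕜 := ℝ) i).continuous.comp
    (intervalIntegral.continuous_primitive (Lp.intervalIntegrable f) 0)

lemma measurable_primitive_apply [NullSingletonClass μ] (i : ι) :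
    Measurable fun p : ℝ × Lp (EuclideanSpace ℝ ι) 2 μ => (∫ x in (0 : ℝ)..p.1, p.2 x ∂μ) i := by
  refine measurable_uncurry_of_continuous_of_measurable
    (u := fun t (f : Lp (EuclideanSpace ℝ ι) 2 μ) => (∫ x in (0 : ℝ)..t, f x ∂μ) i)
    (fun f => continuous_primitive_apply f i) fun t => ?_
  simp only [intervalIntegral, PiLp.sub_apply]
  exact (measurable_setIntegral_apply measurableSet_Ioc i).sub
    (measurable_setIntegral_apply measurableSet_Ioc i)

lemma avg_apply_eq (f : Lp (EuclideanSpace ℝ ι) 2 μ) {ε t : ℝ} (hε : 0 < ε) (ht : 0 ≤ t) (i : ι) :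
    avg μ f ε t i = ε⁻¹ * ((∫ x in (0 : ℝ)..t, f x ∂μ) i -
      (∫ x in (0 : ℝ)..max (t - ε) 0, f x ∂μ) i) := by
  have hle : max (t - ε) 0 ≤ t := max_le (by linarith) ht
  rw [avg, ← intervalIntegral.integral_of_le hle, ← PiLp.sub_apply,
    intervalIntegral.integral_interval_sub_left (Lp.intervalIntegrable f _ _)
      (Lp.intervalIntegrable f _ _)]
  simp

lemma measurable_hatComp [NullSingletonClass μ] {T : ℝ} (i : ι) :
    Measurable fun p : Icc (0 : ℝ) T × Lp (EuclideanSpace ℝ ι) 2 μ =>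
      hatComp μ p.2 (p.1 : ℝ) i := by
  refine measurable_liminf_nhdsGT_zero (fun ε hε => ?_) fun p => ?_
  · simp_rw [fun p : Icc (0 : ℝ) T × Lp (EuclideanSpace ℝ ι) 2 μ =>
      avg_apply_eq p.2 hε p.1.2.1 i]
    have ht : Measurable fun p : Icc (0 : ℝ) T × Lp (EuclideanSpace ℝ ι) 2 μ => (p.1 : ℝ) :=
      measurable_subtype_coe.comp measurable_fst
    have h₁ := (measurable_primitive_apply (μ := μ) i).comp (ht.prodMk measurable_snd)
    have h₂ := (measurable_primitive_apply (μ := μ) i).comp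
      (((ht.sub_const ε).max (measurable_const (a := (0 : ℝ)))).prodMk measurable_snd)
    exact ((h₁.sub h₂).const_mul ε⁻¹).coe_real_ereal
  · refine continuous_coe_real_ereal.comp_continuousOn ?_
    refine ContinuousOn.congr (f := fun ε => ε⁻¹ * ((∫ x in (0 : ℝ)..p.1, p.2 x ∂μ) i -
      (∫ x in (0 : ℝ)..max (p.1 - ε) 0, p.2 x ∂μ) i)) ?_
      fun ε hε => avg_apply_eq p.2 hε p.1.2.1 i
    refine ContinuousOn.mul (continuousOn_inv₀.mono fun ε (hε : (0 : ℝ) < ε) => hε.ne') ?_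
    exact (continuous_const.sub ((continuous_primitive_apply p.2 i).comp
      ((continuous_const.sub continuous_id).max continuous_const))).continuousOn

lemma measurable_precise [NullSingletonClass μ] {T : ℝ} :
    Measurable fun p : Icc (0 : ℝ) T × Lp (EuclideanSpace ℝ ι) 2 μ =>
      precise μ p.2 (p.1 : ℝ) := by
  classical
  have h := fun i : ι => measurable_hatComp (μ := μ) (T := T) i
  unfold precise
  refine Measurable.ite ?_ ?_ measurable_const
  · simp only [ofPred_forall]
    refine MeasurableSet.iInter fun i => ?_
    exact (h i (measurableSet_singleton ⊤).compl).inter (h i (measurableSet_singleton ⊥).compl)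
  · exact (WithLp.measurable_toLp 2 (ι → ℝ)).comp
      (measurable_pi_lambda _ fun i => (h i).ereal_toReal)

end Averages

lemma measurable_V (T : ℝ) (n l d k : ℕ) :
    Measurable fun p : Icc (0 : ℝ) T × PathSpace T n l d k => V T n l d k p.1 p.2 := by
  have heval : ∀ m : ℕ, Measurable
      fun p : Icc (0 : ℝ) T × C(Icc (0 : ℝ) T, EuclideanSpace ℝ (Fin m)) => p.2 p.1 := fun m =>
    measurable_uncurry_of_continuous_of_measurable
      (u := fun (t : Icc (0 : ℝ) T) (x : C(Icc (0 : ℝ) T, EuclideanSpace ℝ (Fin m))) => x t)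
      (fun x => x.continuous) fun t => (continuous_eval_const t).measurable
  have hx : Measurable fun p : Icc (0 : ℝ) T × PathSpace T n l d k => p.2.1 p.1 :=
    (heval n).comp (measurable_fst.prodMk measurable_snd.fst)
  have hy : Measurable fun p : Icc (0 : ℝ) T × PathSpace T n l d k => p.2.2.1 p.1 :=
    (heval l).comp (measurable_fst.prodMk measurable_snd.snd.fst)
  have hz : Measurable fun p : Icc (0 : ℝ) T × PathSpace T n l d k =>
      precise (volume.restrict (Icc (0 : ℝ) T)) p.2.2.2.1 (p.1 : ℝ) :=
    (measurable_precise (ι := Fin l × Fin d) (μ := volume.restrict (Icc (0 : ℝ) T)) (T := T)).comp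
      (f := fun p : Icc (0 : ℝ) T × PathSpace T n l d k => (p.1, p.2.2.2.1))
      (measurable_fst.prodMk measurable_snd.snd.snd.fst)
  have hw : Measurable fun p : Icc (0 : ℝ) T × PathSpace T n l d k =>
      precise (volume.restrict (Icc (0 : ℝ) T)) p.2.2.2.2 (p.1 : ℝ) :=
    (measurable_precise (ι := Fin k) (μ := volume.restrict (Icc (0 : ℝ) T)) (T := T)).comp
      (f := fun p : Icc (0 : ℝ) T × PathSpace T n l d k => (p.1, p.2.2.2.2))
      (measurable_fst.prodMk measurable_snd.snd.snd.snd)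
  exact hx.prodMk (hy.prodMk (hz.prodMk hw))

lemma le_completionSigma {α : Type*} [mα : MeasurableSpace α] (μ : Measure α) :
    mα ≤ completionSigma μ :=
  fun _ hs => MeasurableSet.nullMeasurableSet hs

/-- Joint measurability of parametrized integrals against a kernel depending on one variable. -/
lemma measurable_lintegral_of_markov {A U S : Type*} [MeasurableSpace A] [MeasurableSpace U]
    [MeasurableSpace S] (P : U → Measure S) (hPprob : ∀ u, IsProbabilityMeasure (P u))
    (hPmeas : ∀ s, MeasurableSet s → Measurable fun u => P u s)
    {F : A → U → S → ENNReal} (hF : Measurable fun q : (A × U) × S => F q.1.1 q.1.2 q.2) :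
    Measurable fun p : A × U => ∫⁻ ω, F p.1 p.2 ω ∂(P p.2) := by
  let κ : ProbabilityTheory.Kernel U S := ⟨P, Measure.measurable_of_measurable_coe P hPmeas⟩
  have : ProbabilityTheory.IsMarkovKernel κ := ⟨hPprob⟩
  exact hF.lintegral_kernel_prod_right' (κ := κ.comap Prod.snd measurable_snd)

theorem stmt_3 (T : ℝ) (hT : 0 < T) (n l d k : ℕ)
    (hn : 0 < n) (hl : 0 < l) (hd : 0 < d) (hk : 0 < k)
    (U : Type*) [TopologicalSpace U] [PolishSpace U] [MeasurableSpace U] [BorelSpace U]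
    (m : Measure U) [IsProbabilityMeasure m]
    -- `(ℙᵘ)` is a Markov kernel from `(U, 𝒰)` to `S₁`, `𝒰` the completion of `ℬ(U)` w.r.t. m
    (P : U → Measure (PathSpace T n l d k))
    (hPprob : ∀ u, IsProbabilityMeasure (P u))
    (hPmeas : ∀ A : Set (PathSpace T n l d k), MeasurableSet A →
      @Measurable U ENNReal (completionSigma m) inferInstance (fun u => P u A))
    -- `φ : U × [0,T] × ℝⁿ × ℝˡ × ℝ^{l×d} × ℝᵏ → [0,∞)` Borel measurable
    (φ : U → ℝ → StateSpace n l d k → NNReal)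
    (hφ : Measurable (fun q : U × ℝ × StateSpace n l d k => φ q.1 q.2.1 q.2.2)) :
    @Measurable (Set.Icc (0:ℝ) T × U) ENNReal
      ((completionSigma ((volume : Measure ℝ).comap Subtype.val :
          Measure (Set.Icc (0:ℝ) T))).prod (completionSigma m))
      inferInstance
      (fun p => ∫⁻ ω, (φ p.2 (p.1 : ℝ) (V T n l d k p.1 ω) : ENNReal) ∂(P p.2)) := by
  refine @measurable_lintegral_of_markov _ _ _ (completionSigma _) (completionSigma m) _
    P hPprob hPmeas (fun (t : Icc (0 : ℝ) T) u ω => (φ u (t : ℝ) (V T n l d k t ω) : ENNReal)) ?_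
  have hB : Measurable fun q : (Icc (0 : ℝ) T × U) × PathSpace T n l d k =>
      (φ q.1.2 (q.1.1 : ℝ) (V T n l d k q.1.1 q.2) : ENNReal) := by
    refine (hφ.comp (measurable_fst.snd.prodMk
      ((measurable_subtype_coe.comp measurable_fst.fst).prodMk
        ((measurable_V T n l d k).comp
          (measurable_fst.fst.prodMk measurable_snd))))).coe_nnreal_ennreal
  exact hB.mono (sup_le_sup_right (MeasurableSpace.comap_mono
    (sup_le_sup (MeasurableSpace.comap_mono (le_completionSigma _))
      (MeasurableSpace.comap_mono (le_completionSigma m)))) _) le_rfl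
end

section
/- Let U be a Polish space with Borel σ-algebra, m a Borel probability measure on U, and (E, d) a Polish metric space with a fixed base point x₀ ∈ E. Let (μᵘ)_{u∈U} and (νᵘ)_{u∈U} be Markov kernels from (U, ℬ(U)) to E such that ∫_U ∫_E d(x, x₀)² dμᵘ(x) dm(u) < ∞ and ∫_U ∫_E d(x, x₀)² dνᵘ(x) dm(u) < ∞. Then the map u ↦ W₂²(μᵘ, νᵘ) is Borel measurable on U, and ∫_U W₂²(μᵘ, νᵘ) dm(u) < ∞; in particular the distance W_{2,m}²(μ, ν) := ∫_U W₂²(μᵘ, νᵘ) dm(u) is well defined and finite. -/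
/-!
STATEMENT 5: For Markov kernels (μᵘ), (νᵘ) from a Polish space (U, ℬ(U), m) to a Polish metric
space E with uniformly integrable second moments, u ↦ W₂²(μᵘ, νᵘ) is Borel measurable and
∫_U W₂²(μᵘ, νᵘ) dm(u) < ∞, so the distance W_{2,m} is well defined and finite.
-/

open MeasureTheory

/-- The squared Wasserstein-2 distance: the infimum of `∫ d(x,y)² dπ` over all couplings π
of μ and ν (measures on E × E with first marginal μ and second marginal ν). -/
noncomputable def W2sq {E : Type*} [MeasurableSpace E] [PseudoEMetricSpace E]
    (μ ν : Measure E) : ENNReal :=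
  ⨅ (π : Measure (E × E)) (_ : π.map Prod.fst = μ) (_ : π.map Prod.snd = ν),
    ∫⁻ p, edist p.1 p.2 ^ 2 ∂π

open ProbabilityTheory Filter Topology
open scoped ENNReal NNReal BoundedContinuousFunction

/-- The optimal transport cost between `μ` and `ν` for the cost function `c`. -/
noncomputable def transportCost {E : Type*} [MeasurableSpace E] (c : E × E → ℝ≥0∞)
    (μ ν : Measure E) : ℝ≥0∞ :=
  ⨅ (π : Measure (E × E)) (_ : π.map Prod.fst = μ) (_ : π.map Prod.snd = ν), ∫⁻ p, c p ∂π

lemma transportCost_le {E : Type*} [MeasurableSpace E] (c : E × E → ℝ≥0∞) {μ ν : Measure E}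
    {π : Measure (E × E)} (h₁ : π.map Prod.fst = μ) (h₂ : π.map Prod.snd = ν) :
    transportCost c μ ν ≤ ∫⁻ p, c p ∂π :=
  iInf_le_of_le π (iInf_le_of_le h₁ (iInf_le _ h₂))

/-- A measure with marginals below `μ` and `ν` can be completed to a coupling, and the missing
mass costs at most the bound on the cost function. -/
lemma transportCost_le_of_marginals_le {E : Type*} [MeasurableSpace E] {c : E × E → ℝ≥0∞}
    {K : ℝ≥0∞} (hcK : ∀ p, c p ≤ K) {μ ν : Measure E}
    [IsProbabilityMeasure μ] [IsProbabilityMeasure ν] {π : Measure (E × E)}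
    (h₁ : π.map Prod.fst ≤ μ) (h₂ : π.map Prod.snd ≤ ν) :
    transportCost c μ ν ≤ ∫⁻ p, c p ∂π + K * (1 - π Set.univ) := by
  have hu₁ : π.map Prod.fst Set.univ = π Set.univ := by
    rw [Measure.map_apply measurable_fst MeasurableSet.univ, Set.preimage_univ]
  have hu₂ : π.map Prod.snd Set.univ = π Set.univ := by
    rw [Measure.map_apply measurable_snd MeasurableSet.univ, Set.preimage_univ]
  have : IsFiniteMeasure (π.map Prod.fst) := isFiniteMeasure_of_le μ h₁
  have : IsFiniteMeasure (π.map Prod.snd) := isFiniteMeasure_of_le ν h₂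
  set r := 1 - π Set.univ
  have hrtop : r ≠ ⊤ := ENNReal.sub_ne_top ENNReal.one_ne_top
  have hμ₀ : (μ - π.map Prod.fst) Set.univ = r := by
    rw [Measure.sub_apply MeasurableSet.univ h₁, hu₁, measure_univ]
  have hν₀ : (ν - π.map Prod.snd) Set.univ = r := by
    rw [Measure.sub_apply MeasurableSet.univ h₂, hu₂, measure_univ]
  have key : ∀ ρ : Measure E, ρ Set.univ = r → (r⁻¹ * r) • ρ = ρ := by
    intro ρ hρ
    rcases eq_or_ne r 0 with h0 | h0
    · rw [h0] at hρ
      rw [Measure.measure_univ_eq_zero.1 hρ, smul_zero]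
    · rw [ENNReal.inv_mul_cancel h0 hrtop, one_smul]
  refine (transportCost_le c
    (π := π + r⁻¹ • (μ - π.map Prod.fst).prod (ν - π.map Prod.snd)) ?_ ?_).trans ?_
  · rw [Measure.map_add _ _ measurable_fst, Measure.map_smul, Measure.map_fst_prod, hν₀,
      smul_smul, key _ hμ₀, add_comm, Measure.sub_add_cancel_of_le h₁]
  · rw [Measure.map_add _ _ measurable_snd, Measure.map_smul, Measure.map_snd_prod, hμ₀,
      smul_smul, key _ hν₀, add_comm, Measure.sub_add_cancel_of_le h₂]
  · rw [lintegral_add_measure, lintegral_smul_measure]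
    gcongr
    calc r⁻¹ • ∫⁻ p, c p ∂(μ - π.map Prod.fst).prod (ν - π.map Prod.snd)
        ≤ r⁻¹ • ∫⁻ _, K ∂(μ - π.map Prod.fst).prod (ν - π.map Prod.snd) := by
          gcongr with p
          exact hcK p
      _ = K * ((r⁻¹ * r) * r) := by
          rw [lintegral_const, ← Set.univ_prod_univ, Measure.prod_prod, hμ₀, hν₀, smul_eq_mul]
          ring
      _ ≤ K * (1 * r) := by
          gcongr
          exact ENNReal.inv_mul_le_one r
      _ = K * r := by rw [one_mul]

/-- The joint cell of a pair of points, given the cell of each point. -/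
def cellPair {E : Type*} (ι : E → ℕ) (p : E × E) : ℕ × ℕ := (ι p.1, ι p.2)

lemma measurable_cellPair {E : Type*} [MeasurableSpace E] {ι : E → ℕ} (hι : Measurable ι) :
    Measurable (cellPair ι) :=
  (hι.comp measurable_fst).prodMk (hι.comp measurable_snd)

/-- The density `σ`, constant on products of cells, has marginals below `μ` and `ν`. -/
def IsSubcoupling {E : Type*} [MeasurableSpace E] (ι : E → ℕ) (σ : ℕ × ℕ → ℝ≥0∞)
    (μ ν : Measure E) : Prop :=
  (∀ i, μ (ι ⁻¹' {i}) * ∫⁻ y, σ (i, ι y) ∂ν ≤ μ (ι ⁻¹' {i})) ∧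
    ∀ j, ν (ι ⁻¹' {j}) * ∫⁻ x, σ (ι x, j) ∂μ ≤ ν (ι ⁻¹' {j})

lemma IsSubcoupling.mono {E : Type*} [MeasurableSpace E] {ι : E → ℕ} {σ τ : ℕ × ℕ → ℝ≥0∞}
    {μ ν : Measure E} (h : IsSubcoupling ι τ μ ν) (hστ : σ ≤ τ) : IsSubcoupling ι σ μ ν :=
  ⟨fun i => (mul_le_mul_right (lintegral_mono fun _ => hστ _) _).trans (h.1 i),
    fun j => (mul_le_mul_right (lintegral_mono fun _ => hστ _) _).trans (h.2 j)⟩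

open Classical in
/-- The cost of the subcoupling with density `σ`, the missing mass being charged at rate `K`. -/
noncomputable def densityCost {E : Type*} [MeasurableSpace E] (c : E × E → ℝ≥0∞) (K : ℝ≥0∞)
    (ι : E → ℕ) (σ : ℕ × ℕ → ℝ≥0∞) (μ ν : Measure E) : ℝ≥0∞ :=
  if IsSubcoupling ι σ μ ν then
    ∫⁻ p, σ (cellPair ι p) * c p ∂(μ.prod ν) + K * (1 - ∫⁻ p, σ (cellPair ι p) ∂(μ.prod ν))
  else ⊤

lemma ae_le_one_of_measure_mul_le {E : Type*} [MeasurableSpace E] {ι : E → ℕ}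
    {g : ℕ → ℝ≥0∞} {μ : Measure E} [IsFiniteMeasure μ]
    (h : ∀ i, μ (ι ⁻¹' {i}) * g i ≤ μ (ι ⁻¹' {i})) : ∀ᵐ x ∂μ, g (ι x) ≤ 1 := by
  have : ∀ i, ∀ᵐ x ∂μ, ι x = i → g i ≤ 1 := by
    intro i
    by_cases hi : g i ≤ 1
    · exact ae_of_all _ fun _ _ => hi
    · have h0 : μ (ι ⁻¹' {i}) = 0 := by
        by_contra h0
        refine hi ?_
        have := h i
        nth_rw 2 [← mul_one (μ (ι ⁻¹' {i}))] at this
        exact (ENNReal.mul_le_mul_iff_right h0 (measure_ne_top _ _)).1 this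
      refine measure_mono_null (fun x hx => ?_) h0
      simp only [Set.mem_compl_iff, Set.mem_ofPred_eq, Classical.not_imp] at hx
      exact hx.1
  filter_upwards [ae_all_iff.2 this] with x hx
  exact hx _ rfl

lemma transportCost_le_densityCost {E : Type*} [MeasurableSpace E] {c : E × E → ℝ≥0∞}
    (hc : Measurable c) {K : ℝ≥0∞} (hcK : ∀ p, c p ≤ K) {ι : E → ℕ} (hι : Measurable ι)
    (σ : ℕ × ℕ → ℝ≥0∞) (μ ν : Measure E) [IsProbabilityMeasure μ] [IsProbabilityMeasure ν] :
    transportCost c μ ν ≤ densityCost c K ι σ μ ν := by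
  unfold densityCost
  split_ifs with h
  swap
  · exact le_top
  have hσ : Measurable fun p => σ (cellPair ι p) :=
    (Measurable.of_discrete (f := σ)).comp (measurable_cellPair hι)
  have key := transportCost_le_of_marginals_le hcK (μ := μ) (ν := ν)
    (π := (μ.prod ν).withDensity fun p => σ (cellPair ι p)) ?_ ?_
  · rwa [lintegral_withDensity_eq_lintegral_mul _ hσ hc, withDensity_apply _ MeasurableSet.univ,
      Measure.restrict_univ] at key
  · refine Measure.le_iff.2 fun A hA => ?_
    rw [Measure.map_apply measurable_fst hA, withDensity_apply _ (measurable_fst hA),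
      ← Set.prod_univ, ← Measure.prod_restrict, Measure.restrict_univ,
      lintegral_prod _ hσ.aemeasurable, ← setLIntegral_one]
    exact lintegral_mono_ae (ae_restrict_of_ae
      (ae_le_one_of_measure_mul_le (g := fun i => ∫⁻ y, σ (i, ι y) ∂ν) h.1))
  · refine Measure.le_iff.2 fun A hA => ?_
    rw [Measure.map_apply measurable_snd hA, withDensity_apply _ (measurable_snd hA),
      ← Set.univ_prod, ← Measure.prod_restrict, Measure.restrict_univ,
      lintegral_prod_symm _ hσ.aemeasurable, ← setLIntegral_one]
    exact lintegral_mono_ae (ae_restrict_of_ae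
      (ae_le_one_of_measure_mul_le (g := fun j => ∫⁻ x, σ (ι x, j) ∂μ) h.2))

lemma measurable_densityCost {U E : Type*} [MeasurableSpace U] [MeasurableSpace E]
    {c : E × E → ℝ≥0∞} (hc : Measurable c) (K : ℝ≥0∞) {ι : E → ℕ} (hι : Measurable ι)
    (σ : ℕ × ℕ → ℝ≥0∞) (μ ν : Kernel U E) [IsMarkovKernel μ] [IsMarkovKernel ν] :
    Measurable fun u => densityCost c K ι σ (μ u) (ν u) := by
  have hσ : Measurable fun p => σ (cellPair ι p) :=
    (Measurable.of_discrete (f := σ)).comp (measurable_cellPair hι)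
  have hprod : ∀ g : E × E → ℝ≥0∞, Measurable g →
      Measurable fun u => ∫⁻ p, g p ∂((μ u).prod (ν u)) := by
    intro g hg
    simp_rw [← Kernel.prod_apply]
    exact hg.lintegral_kernel
  have hcell : ∀ i, MeasurableSet (ι ⁻¹' {i}) := fun i => hι (measurableSet_singleton i)
  refine Measurable.ite ?_ ?_ measurable_const
  · unfold IsSubcoupling
    simp only [Set.ofPred_and, Set.ofPred_forall]
    refine MeasurableSet.inter (MeasurableSet.iInter fun i => ?_)
      (MeasurableSet.iInter fun j => ?_)
    · refine measurableSet_le ?_ (μ.measurable_coe (hcell i))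
      exact (μ.measurable_coe (hcell i)).mul (Measurable.lintegral_kernel
        ((Measurable.of_discrete (f := fun k => σ (i, k))).comp hι))
    · refine measurableSet_le ?_ (ν.measurable_coe (hcell j))
      exact (ν.measurable_coe (hcell j)).mul (Measurable.lintegral_kernel
        ((Measurable.of_discrete (f := fun k => σ (k, j))).comp hι))
  · exact (hprod _ (hσ.mul hc)).add ((measurable_const.sub (hprod _ hσ)).const_mul K)

/-- Finite suprema of countably many multiples of indicators of points, which are dense from
below among all functions on `ℕ × ℕ`. -/
noncomputable def finsetSup (T : Finset ℕ) (p : ℕ × ℕ) : ℝ≥0∞ :=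
  T.sup fun n => if n.unpair.1.unpair = p then TopologicalSpace.denseSeq ℝ≥0∞ n.unpair.2 else 0

lemma exists_monotone_finsetSup (f : ℕ × ℕ → ℝ≥0∞) :
    ∃ T : ℕ → Finset ℕ, Monotone T ∧ (∀ k, finsetSup (T k) ≤ f) ∧
      ∀ p, ⨆ k, finsetSup (T k) p = f p := by
  classical
  let q := TopologicalSpace.denseSeq ℝ≥0∞
  let T : ℕ → Finset ℕ := fun k =>
    (Finset.range k).filter fun n => q n.unpair.2 ≤ f n.unpair.1.unpair
  have hle : ∀ k, finsetSup (T k) ≤ f := by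
    intro k p
    refine Finset.sup_le fun n hn => ?_
    split_ifs with h
    · exact h ▸ (Finset.mem_filter.1 hn).2
    · exact zero_le
  refine ⟨T, fun k l hkl => Finset.filter_subset_filter _ (Finset.range_mono hkl), hle,
    fun p => le_antisymm (iSup_le fun k => hle k p) ?_⟩
  refine le_of_forall_lt fun a ha => ?_
  obtain ⟨_, ⟨m, rfl⟩, ham, hmf⟩ :=
    (TopologicalSpace.denseRange_denseSeq ℝ≥0∞).exists_between ha
  refine ham.trans_le (le_iSup_of_le (Nat.pair (Nat.pair p.1 p.2) m + 1) ?_)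
  have hmem : Nat.pair (Nat.pair p.1 p.2) m ∈ T (Nat.pair (Nat.pair p.1 p.2) m + 1) := by
    simp only [T, Finset.mem_filter, Finset.mem_range, Nat.unpair_pair, q]
    exact ⟨Nat.lt_succ_self _, hmf.le⟩
  refine le_trans ?_ (Finset.le_sup hmem)
  simp

lemma finsetSup_mono {S T : Finset ℕ} (h : S ⊆ T) : finsetSup S ≤ finsetSup T :=
  fun _ => Finset.sup_mono h

/-- The image of a coupling on the cells has a density with respect to the image of the
product measure. -/
lemma exists_density_of_coupling {E : Type*} [MeasurableSpace E] {ι : E → ℕ}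
    (hι : Measurable ι) {μ ν : Measure E} [IsProbabilityMeasure μ] [IsProbabilityMeasure ν]
    {π : Measure (E × E)} (h₁ : π.map Prod.fst = μ) (h₂ : π.map Prod.snd = ν) :
    ∃ f : ℕ × ℕ → ℝ≥0∞, ∀ h : ℕ × ℕ → ℝ≥0∞,
      ∫⁻ p, f (cellPair ι p) * h (cellPair ι p) ∂(μ.prod ν) = ∫⁻ p, h (cellPair ι p) ∂π := by
  have hJ := measurable_cellPair hι
  have : IsProbabilityMeasure (π.map Prod.fst) := h₁ ▸ inferInstance
  have : IsProbabilityMeasure π :=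
    Measure.isProbabilityMeasure_of_map Prod.fst
  have hac : π.map (cellPair ι) ≪ (μ.prod ν).map (cellPair ι) := by
    intro S hS
    rw [← Set.biUnion_of_singleton S, measure_biUnion_null_iff S.to_countable] at hS ⊢
    rintro ⟨i, j⟩ hij
    have h0 := hS _ hij
    have hcell : cellPair ι ⁻¹' {(i, j)} = (ι ⁻¹' {i}) ×ˢ (ι ⁻¹' {j}) := by
      ext p
      simp [cellPair]
    rw [Measure.map_apply hJ (measurableSet_singleton _), hcell] at h0 ⊢
    rw [Measure.prod_prod, mul_eq_zero] at h0
    rcases h0 with h0 | h0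
    · rw [← h₁, Measure.map_apply measurable_fst (hι (measurableSet_singleton i))] at h0
      exact measure_mono_null (fun p hp => hp.1) h0
    · rw [← h₂, Measure.map_apply measurable_snd (hι (measurableSet_singleton j))] at h0
      exact measure_mono_null (fun p hp => hp.2) h0
  refine ⟨(π.map (cellPair ι)).rnDeriv ((μ.prod ν).map (cellPair ι)), fun h => ?_⟩
  have hh : Measurable h := Measurable.of_discrete
  rw [← lintegral_map hh hJ]
  conv_rhs => rw [← Measure.withDensity_rnDeriv_eq _ _ hac]
  rw [lintegral_withDensity_eq_lintegral_mul _ (Measure.measurable_rnDeriv _ _) hh,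
    lintegral_map ((Measure.measurable_rnDeriv _ _).mul hh) hJ]
  rfl

lemma exists_densityCost_le {E : Type*} [MeasurableSpace E] {c : E × E → ℝ≥0∞}
    (hc : Measurable c) {K : ℝ≥0∞} {ι : E → ℕ} (hι : Measurable ι) {η : ℝ≥0∞}
    (hη : ∀ p p', cellPair ι p = cellPair ι p' → c p ≤ c p' + η)
    {μ ν : Measure E} [IsProbabilityMeasure μ] [IsProbabilityMeasure ν]
    {π : Measure (E × E)} (h₁ : π.map Prod.fst = μ) (h₂ : π.map Prod.snd = ν)
    {ε : ℝ≥0∞} (hε : 0 < ε) :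
    ∃ T : Finset ℕ, densityCost c K ι (finsetSup T) μ ν ≤ ∫⁻ p, c p ∂π + η + K * ε := by
  have hJ := measurable_cellPair hι
  have : IsProbabilityMeasure (π.map Prod.fst) := h₁ ▸ inferInstance
  have : IsProbabilityMeasure π :=
    Measure.isProbabilityMeasure_of_map Prod.fst
  obtain ⟨f, hf⟩ := exists_density_of_coupling hι h₁ h₂
  obtain ⟨T, hTmono, hTf, hTsup⟩ := exists_monotone_finsetSup f
  have hfm : Measurable f := Measurable.of_discrete
  have hsub : IsSubcoupling ι f μ ν := by
    have hfJ : Measurable fun p => f (cellPair ι p) := hfm.comp hJ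
    refine ⟨fun i => ?_, fun j => ?_⟩
    · have hA : MeasurableSet (ι ⁻¹' {i}) := hι (measurableSet_singleton i)
      refine le_of_eq ?_
      calc μ (ι ⁻¹' {i}) * ∫⁻ y, f (i, ι y) ∂ν
          = ∫⁻ x in ι ⁻¹' {i}, ∫⁻ y, f (cellPair ι (x, y)) ∂ν ∂μ := by
            rw [mul_comm, ← setLIntegral_const]
            refine setLIntegral_congr_fun hA fun x hx => ?_
            simp only [cellPair, show ι x = i from hx]
        _ = ∫⁻ p in Prod.fst ⁻¹' (ι ⁻¹' {i}), f (cellPair ι p) ∂(μ.prod ν) := by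
            rw [← Set.prod_univ, ← Measure.prod_restrict, Measure.restrict_univ,
              lintegral_prod _ hfJ.aemeasurable]
        _ = ∫⁻ p, f (cellPair ι p) * ({q | q.1 = i} : Set (ℕ × ℕ)).indicator 1 (cellPair ι p)
              ∂(μ.prod ν) := by
            rw [← lintegral_indicator (measurable_fst hA)]
            refine lintegral_congr fun p => ?_
            by_cases hp : ι p.1 = i <;> simp [Set.indicator, cellPair, hp]
        _ = ∫⁻ p, (Prod.fst ⁻¹' (ι ⁻¹' {i})).indicator 1 p ∂π := hf _
        _ = μ (ι ⁻¹' {i}) := by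
            rw [lintegral_indicator_one (measurable_fst hA), ← h₁,
              Measure.map_apply measurable_fst hA]
    · have hA : MeasurableSet (ι ⁻¹' {j}) := hι (measurableSet_singleton j)
      refine le_of_eq ?_
      calc ν (ι ⁻¹' {j}) * ∫⁻ x, f (ι x, j) ∂μ
          = ∫⁻ y in ι ⁻¹' {j}, ∫⁻ x, f (cellPair ι (x, y)) ∂μ ∂ν := by
            rw [mul_comm, ← setLIntegral_const]
            refine setLIntegral_congr_fun hA fun y hy => ?_
            simp only [cellPair, show ι y = j from hy]
        _ = ∫⁻ p in Prod.snd ⁻¹' (ι ⁻¹' {j}), f (cellPair ι p) ∂(μ.prod ν) := by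
            rw [← Set.univ_prod, ← Measure.prod_restrict, Measure.restrict_univ,
              lintegral_prod_symm _ hfJ.aemeasurable]
        _ = ∫⁻ p, f (cellPair ι p) * ({q | q.2 = j} : Set (ℕ × ℕ)).indicator 1 (cellPair ι p)
              ∂(μ.prod ν) := by
            rw [← lintegral_indicator (measurable_snd hA)]
            refine lintegral_congr fun p => ?_
            by_cases hp : ι p.2 = j <;> simp [Set.indicator, cellPair, hp]
        _ = ∫⁻ p, (Prod.snd ⁻¹' (ι ⁻¹' {j})).indicator 1 p ∂π := hf _
        _ = ν (ι ⁻¹' {j}) := by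
            rw [lintegral_indicator_one (measurable_snd hA), ← h₂,
              Measure.map_apply measurable_snd hA]
  have hmass : Tendsto (fun k => ∫⁻ p, finsetSup (T k) (cellPair ι p) ∂(μ.prod ν)) atTop
      (𝓝 1) := by
    have hone := hf fun _ => 1
    simp only [mul_one, lintegral_one, measure_univ] at hone
    rw [← hone]
    refine lintegral_tendsto_of_tendsto_of_monotone
      (fun k => ((Measurable.of_discrete (f := finsetSup (T k))).comp hJ).aemeasurable)
      (ae_of_all _ fun p k l hkl => finsetSup_mono (hTmono hkl) _)
      (ae_of_all _ fun p => ?_)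
    rw [← hTsup]
    exact tendsto_atTop_iSup fun k l hkl => finsetSup_mono (hTmono hkl) _
  obtain ⟨k, hk⟩ : ∃ k, 1 - ∫⁻ p, finsetSup (T k) (cellPair ι p) ∂(μ.prod ν) ≤ ε := by
    have := ENNReal.Tendsto.sub (tendsto_const_nhds (x := (1 : ℝ≥0∞))) hmass
      (Or.inl ENNReal.one_ne_top)
    rw [tsub_self] at this
    exact ((this.eventually_lt_const hε).exists).imp fun _ => le_of_lt
  refine ⟨T k, ?_⟩
  rw [densityCost, if_pos (hsub.mono (hTf k))]
  gcongr
  let h : ℕ × ℕ → ℝ≥0∞ := fun q => ⨆ (p) (_ : cellPair ι p = q), c p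
  calc ∫⁻ p, finsetSup (T k) (cellPair ι p) * c p ∂(μ.prod ν)
      ≤ ∫⁻ p, f (cellPair ι p) * h (cellPair ι p) ∂(μ.prod ν) := by
        refine lintegral_mono fun p => mul_le_mul' (hTf k _) ?_
        exact le_iSup₂_of_le p rfl le_rfl
    _ = ∫⁻ p, h (cellPair ι p) ∂π := hf h
    _ ≤ ∫⁻ p, (c p + η) ∂π := lintegral_mono fun p => iSup₂_le fun p' hp' => hη p' p hp'
    _ = ∫⁻ p, c p ∂π + η := by
        rw [lintegral_add_left hc, lintegral_const, measure_univ, mul_one]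

/-- A separable metric space has countable measurable partitions of arbitrarily small mesh. -/
lemma exists_measurable_cell {E : Type*} [PseudoEMetricSpace E]
    [TopologicalSpace.SeparableSpace E] [Nonempty E] [MeasurableSpace E]
    [OpensMeasurableSpace E] {δ : ℝ≥0∞} (hδ : 0 < δ) :
    ∃ ι : E → ℕ, Measurable ι ∧ ∀ x y, ι x = ι y → edist x y ≤ δ := by
  classical
  have hex : ∀ x : E, ∃ n, edist x (TopologicalSpace.denseSeq E n) < δ / 2 := by
    intro x
    obtain ⟨_, ⟨n, rfl⟩, hn⟩ := EMetric.mem_closure_iff.1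
      (TopologicalSpace.denseRange_denseSeq E x) (δ / 2) (ENNReal.half_pos hδ.ne')
    exact ⟨n, hn⟩
  refine ⟨fun x => Nat.find (hex x), measurable_find hex fun n => ?_, fun x y hxy => ?_⟩
  · exact (Metric.isOpen_eball (x := TopologicalSpace.denseSeq E n)).measurableSet
  · have hx := Nat.find_spec (hex x)
    have hy := Nat.find_spec (hex y)
    simp only at hxy
    rw [← hxy] at hy
    calc edist x y ≤ _ + _ := edist_triangle_right _ _ _
      _ ≤ δ / 2 + δ / 2 := add_le_add hx.le hy.le
      _ = δ := ENNReal.add_halves δ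

/-- If the cost is bounded and oscillates little on products of small cells, then the optimal
transport cost between Markov kernels is measurable. -/
lemma measurable_transportCost_of_osc {U E : Type*} [MeasurableSpace U] [MeasurableSpace E]
    {c : E × E → ℝ≥0∞} (hc : Measurable c) {K : ℝ≥0∞} (hK : K ≠ ⊤) (hcK : ∀ p, c p ≤ K)
    (hosc : ∀ η > 0, ∃ ι : E → ℕ, Measurable ι ∧
      ∀ p p', cellPair ι p = cellPair ι p' → c p ≤ c p' + η)
    (μ ν : Kernel U E) [IsMarkovKernel μ] [IsMarkovKernel ν] :
    Measurable fun u => transportCost c (μ u) (ν u) := by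
  choose ι hι hcι using fun n : ℕ => hosc (n : ℝ≥0∞)⁻¹
    (ENNReal.inv_pos.2 (ENNReal.natCast_ne_top n))
  have heq : ∀ u, transportCost c (μ u) (ν u) =
      ⨅ (n : ℕ) (T : Finset ℕ), densityCost c K (ι n) (finsetSup T) (μ u) (ν u) := by
    intro u
    refine le_antisymm (le_iInf₂ fun n T =>
      transportCost_le_densityCost hc hcK (hι n) _ _ _) ?_
    refine le_iInf fun π => le_iInf₂ fun h₁ h₂ => ?_
    refine _root_.le_of_forall_gt fun a ha => ?_
    have hlim : Tendsto (fun n : ℕ => ∫⁻ p, c p ∂π + (n : ℝ≥0∞)⁻¹ + K * (n : ℝ≥0∞)⁻¹) atTop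
        (𝓝 (∫⁻ p, c p ∂π + 0 + K * 0)) :=
      (tendsto_const_nhds.add ENNReal.tendsto_inv_nat_nhds_zero).add
        (ENNReal.Tendsto.const_mul ENNReal.tendsto_inv_nat_nhds_zero (Or.inr hK))
    rw [mul_zero, add_zero, add_zero] at hlim
    obtain ⟨n, hn⟩ := (hlim.eventually_lt_const ha).exists
    obtain ⟨T, hT⟩ := exists_densityCost_le hc (K := K) (hι n) (hcι n) h₁ h₂
      (ENNReal.inv_pos.2 (ENNReal.natCast_ne_top n))
    exact (iInf₂_le_of_le n T hT).trans_lt hn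
  simp_rw [heq]
  exact Measurable.iInf fun n => Measurable.iInf fun T =>
    measurable_densityCost hc K (hι n) _ μ ν

/-- The truncated quadratic cost. -/
noncomputable def truncCost {E : Type*} [PseudoMetricSpace E] (N : ℕ) (p : E × E) : ℝ≥0 :=
  min (nndist p.1 p.2) N ^ 2

lemma continuous_truncCost {E : Type*} [PseudoMetricSpace E] (N : ℕ) :
    Continuous (truncCost N : E × E → ℝ≥0) :=
  ((continuous_nndist).min continuous_const).pow 2

lemma truncCost_le {E : Type*} [PseudoMetricSpace E] (N : ℕ) (p : E × E) :
    truncCost N p ≤ (N : ℝ≥0) ^ 2 :=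
  pow_le_pow_left₀ zero_le (min_le_right _ _) 2

lemma truncCost_mono {E : Type*} [PseudoMetricSpace E] {M N : ℕ} (h : M ≤ N) (p : E × E) :
    truncCost M p ≤ truncCost N p :=
  pow_le_pow_left₀ zero_le (min_le_min_left _ (Nat.cast_le.2 h)) 2

lemma iSup_truncCost {E : Type*} [PseudoMetricSpace E] (p : E × E) :
    ⨆ N, (truncCost N p : ℝ≥0∞) = edist p.1 p.2 ^ 2 := by
  refine le_antisymm (iSup_le fun N => ?_) ?_
  · rw [edist_nndist, ← ENNReal.coe_pow, ENNReal.coe_le_coe]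
    exact pow_le_pow_left₀ zero_le (min_le_left _ _) 2
  · obtain ⟨N, hN⟩ := exists_nat_ge (nndist p.1 p.2)
    refine le_iSup_of_le N ?_
    rw [truncCost, min_eq_left hN, edist_nndist, ENNReal.coe_pow]

lemma truncCost_osc {E : Type*} [PseudoMetricSpace E] (N : ℕ) {δ : ℝ≥0} (hδ : δ ≤ 1)
    {p p' : E × E} (h₁ : nndist p.1 p'.1 ≤ δ) (h₂ : nndist p.2 p'.2 ≤ δ) :
    truncCost N p ≤ truncCost N p' + 4 * (N + 1) * δ := by
  have htri : nndist p.1 p.2 ≤ nndist p'.1 p'.2 + 2 * δ := by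
    calc nndist p.1 p.2 ≤ nndist p.1 p'.1 + nndist p'.1 p'.2 + nndist p'.2 p.2 :=
          (nndist_triangle _ p'.2 _).trans (add_le_add_left (nndist_triangle _ p'.1 _) _)
      _ ≤ δ + nndist p'.1 p'.2 + δ := by
          rw [nndist_comm p'.2 p.2]
          gcongr
      _ = nndist p'.1 p'.2 + 2 * δ := by ring
  have hmin : min (nndist p.1 p.2) (N : ℝ≥0) ≤ min (nndist p'.1 p'.2) N + 2 * δ := by
    rw [min_add]
    exact min_le_min htri le_self_add
  have hN : min (nndist p'.1 p'.2) (N : ℝ≥0) ≤ N := min_le_right _ _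
  unfold truncCost
  set m := min (nndist p'.1 p'.2) (N : ℝ≥0)
  calc min (nndist p.1 p.2) (N : ℝ≥0) ^ 2 ≤ (m + 2 * δ) ^ 2 := by gcongr
    _ = m ^ 2 + 4 * (m + δ) * δ := by ring
    _ ≤ m ^ 2 + 4 * (N + 1) * δ := by gcongr

lemma measurable_transportCost_truncCost {U E : Type*} [MeasurableSpace U]
    [PseudoMetricSpace E] [TopologicalSpace.SeparableSpace E] [Nonempty E] [MeasurableSpace E]
    [BorelSpace E] (N : ℕ) (μ ν : Kernel U E) [IsMarkovKernel μ] [IsMarkovKernel ν] :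
    Measurable fun u => transportCost (fun p => (truncCost N p : ℝ≥0∞)) (μ u) (ν u) := by
  have : SecondCountableTopology E := UniformSpace.secondCountable_of_separable E
  refine measurable_transportCost_of_osc
    (continuous_truncCost N).measurable.coe_nnreal_ennreal (K := ((N : ℝ≥0) ^ 2 : ℝ≥0))
    ENNReal.coe_ne_top (fun p => ENNReal.coe_le_coe.2 (truncCost_le N p)) (fun η hη => ?_) μ ν
  obtain ⟨η', hη', hη'η⟩ := ENNReal.lt_iff_exists_nnreal_btwn.1 hη
  rw [ENNReal.coe_pos] at hη'
  have hN : (0 : ℝ≥0) < 4 * (N + 1) := by positivity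
  obtain ⟨ι, hι, hδ⟩ := exists_measurable_cell (E := E)
    (δ := (min 1 (η' / (4 * (N + 1))) : ℝ≥0))
    (ENNReal.coe_pos.2 (lt_min one_pos (div_pos hη' hN)))
  refine ⟨ι, hι, fun p p' hpp' => ?_⟩
  have h₁ := hδ _ _ (congrArg Prod.fst hpp')
  have h₂ := hδ _ _ (congrArg Prod.snd hpp')
  rw [edist_nndist, ENNReal.coe_le_coe] at h₁ h₂
  refine le_trans ?_ (add_le_add_right hη'η.le _)
  rw [← ENNReal.coe_add, ENNReal.coe_le_coe]
  refine (truncCost_osc N (min_le_left _ _) h₁ h₂).trans ?_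
  gcongr
  calc 4 * (N + 1) * min 1 (η' / (4 * (N + 1))) ≤ 4 * (N + 1) * (η' / (4 * (N + 1))) := by
        gcongr
        exact min_le_right _ _
    _ = η' := mul_div_cancel₀ _ (ne_of_gt hN)

/-- The couplings of two probability measures. -/
def couplings {E : Type*} [MeasurableSpace E] (μ ν : Measure E) :
    Set (ProbabilityMeasure (E × E)) :=
  {π | (π : Measure (E × E)).map Prod.fst = μ ∧ (π : Measure (E × E)).map Prod.snd = ν}

lemma isCompact_couplings {E : Type*} [MetricSpace E] [CompleteSpace E]
    [SecondCountableTopology E] [MeasurableSpace E] [BorelSpace E]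
    (μ ν : Measure E) [IsProbabilityMeasure μ] [IsProbabilityMeasure ν] :
    IsCompact (couplings μ ν) := by
  have hclosed : IsClosed (couplings μ ν) := by
    have h₁ := (isClosed_singleton (X := ProbabilityMeasure E) (x := ⟨μ, inferInstance⟩)).preimage
      (ProbabilityMeasure.continuous_map (continuous_fst (X := E) (Y := E)))
    have h₂ := (isClosed_singleton (X := ProbabilityMeasure E) (x := ⟨ν, inferInstance⟩)).preimage
      (ProbabilityMeasure.continuous_map (continuous_snd (X := E) (Y := E)))
    convert h₁.inter h₂ using 1
    ext π
    exact and_congr (Subtype.ext_iff (a1 := π.map _) (a2 := ⟨μ, inferInstance⟩)).symm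
      (Subtype.ext_iff (a1 := π.map _) (a2 := ⟨ν, inferInstance⟩)).symm
  rw [← hclosed.closure_eq]
  refine isCompact_closure_of_isTightMeasureSet ?_
  rw [isTightMeasureSet_iff_exists_isCompact_measure_compl_le]
  intro ε hε
  obtain ⟨A, hA, hμA⟩ := isTightMeasureSet_iff_exists_isCompact_measure_compl_le.1
    (isTightMeasureSet_singleton (μ := μ)) (ε / 2) (ENNReal.half_pos hε.ne')
  obtain ⟨B, hB, hνB⟩ := isTightMeasureSet_iff_exists_isCompact_measure_compl_le.1
    (isTightMeasureSet_singleton (μ := ν)) (ε / 2) (ENNReal.half_pos hε.ne')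
  refine ⟨A ×ˢ B, hA.prod hB, ?_⟩
  rintro _ ⟨π, ⟨h₁, h₂⟩, rfl⟩
  calc (π : Measure (E × E)) (A ×ˢ B)ᶜ
      ≤ (π : Measure (E × E)) (Prod.fst ⁻¹' Aᶜ) + (π : Measure (E × E)) (Prod.snd ⁻¹' Bᶜ) := by
        refine (measure_mono fun p hp => ?_).trans (measure_union_le _ _)
        simp only [Set.mem_compl_iff, Set.mem_prod, not_and_or] at hp
        exact hp
    _ = μ Aᶜ + ν Bᶜ := by
        rw [← Measure.map_apply measurable_fst hA.measurableSet.compl, h₁,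
          ← Measure.map_apply measurable_snd hB.measurableSet.compl, h₂]
    _ ≤ ε / 2 + ε / 2 := add_le_add (hμA μ rfl) (hνB ν rfl)
    _ = ε := ENNReal.add_halves ε

lemma continuous_lintegral_truncCost {E : Type*} [MetricSpace E] [SecondCountableTopology E]
    [MeasurableSpace E] [BorelSpace E] (N : ℕ) :
    Continuous fun π : ProbabilityMeasure (E × E) =>
      ∫⁻ p, (truncCost N p : ℝ≥0∞) ∂(π : Measure (E × E)) := by
  let f : E × E →ᵇ ℝ≥0 := BoundedContinuousFunction.mkOfBound
    ⟨truncCost N, continuous_truncCost N⟩ ((N : ℝ) ^ 2) fun p q => by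
      have hp : (truncCost N p : ℝ) ≤ (N : ℝ) ^ 2 := by exact_mod_cast truncCost_le N p
      have hq : (truncCost N q : ℝ) ≤ (N : ℝ) ^ 2 := by exact_mod_cast truncCost_le N q
      exact abs_sub_le_of_nonneg_of_le (NNReal.coe_nonneg _) hp (NNReal.coe_nonneg _) hq
  exact continuous_iff_continuousAt.2 fun π =>
    ProbabilityMeasure.tendsto_iff_forall_lintegral_tendsto.1 tendsto_id f

/-- By compactness of the set of couplings, `W2sq` is the supremum of the optimal transport costs
for the truncated quadratic costs. -/
lemma W2sq_eq_iSup_transportCost {E : Type*} [MetricSpace E] [CompleteSpace E]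
    [SecondCountableTopology E] [MeasurableSpace E] [BorelSpace E]
    (μ ν : Measure E) [IsProbabilityMeasure μ] [IsProbabilityMeasure ν] :
    W2sq μ ν = ⨆ N : ℕ, transportCost (fun p => (truncCost N p : ℝ≥0∞)) μ ν := by
  refine le_antisymm ?_ (iSup_le fun N => ?_)
  · set t := ⨆ N : ℕ, transportCost (fun p => (truncCost N p : ℝ≥0∞)) μ ν
    refine ENNReal.le_of_forall_pos_le_add fun ε hε htop => ?_
    let S : ℕ → Set (ProbabilityMeasure (E × E)) := fun N =>
      couplings μ ν ∩ {π | ∫⁻ p, (truncCost N p : ℝ≥0∞) ∂(π : Measure (E × E)) ≤ t + ε}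
    have hclosed : ∀ N, IsClosed
        {π : ProbabilityMeasure (E × E) |
          ∫⁻ p, (truncCost N p : ℝ≥0∞) ∂(π : Measure (E × E)) ≤ t + ε} :=
      fun N => isClosed_le (continuous_lintegral_truncCost N) continuous_const
    have hcomp := isCompact_couplings μ ν
    have hne : ∀ N, (S N).Nonempty := by
      intro N
      have hlt : transportCost (fun p => (truncCost N p : ℝ≥0∞)) μ ν < t + ε :=
        (le_iSup (fun N : ℕ => transportCost (fun p => (truncCost N p : ℝ≥0∞)) μ ν)
          N).trans_lt (ENNReal.lt_add_right htop.ne (ENNReal.coe_pos.2 hε).ne')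
      simp only [transportCost, iInf_lt_iff] at hlt
      obtain ⟨π, h₁, h₂, hlt⟩ := hlt
      have : IsProbabilityMeasure (π.map Prod.fst) := h₁ ▸ inferInstance
      exact ⟨⟨π, Measure.isProbabilityMeasure_of_map Prod.fst⟩, ⟨h₁, h₂⟩, hlt.le⟩
    obtain ⟨π, hπ⟩ := IsCompact.nonempty_iInter_of_sequence_nonempty_isCompact_isClosed S
      (fun N => Set.inter_subset_inter_right _ fun π hπ => le_trans
        (lintegral_mono fun p => ENNReal.coe_le_coe.2 (truncCost_mono N.le_succ p)) hπ)
      hne (hcomp.inter_right (hclosed 0)) (fun N => hcomp.isClosed.inter (hclosed N))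
    rw [Set.mem_iInter] at hπ
    refine (transportCost_le (fun p => edist p.1 p.2 ^ 2) (hπ 0).1.1 (hπ 0).1.2).trans ?_
    simp_rw [← iSup_truncCost]
    rw [lintegral_iSup (fun N => (continuous_truncCost N).measurable.coe_nnreal_ennreal)
      (fun M N h p => ENNReal.coe_le_coe.2 (truncCost_mono h p))]
    exact iSup_le fun N => (hπ N).2
  · refine le_iInf fun π => le_iInf₂ fun h₁ h₂ => (transportCost_le _ h₁ h₂).trans ?_
    refine lintegral_mono fun p => ?_
    rw [← iSup_truncCost]
    exact le_iSup (fun N => (truncCost N p : ℝ≥0∞)) N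

lemma W2sq_le_second_moments {E : Type*} [MetricSpace E] [SecondCountableTopology E]
    [MeasurableSpace E] [BorelSpace E] (x₀ : E)
    (μ ν : Measure E) [IsProbabilityMeasure μ] [IsProbabilityMeasure ν] :
    W2sq μ ν ≤ 2 * (∫⁻ x, edist x x₀ ^ 2 ∂μ + ∫⁻ x, edist x x₀ ^ 2 ∂ν) := by
  have hm : Measurable fun x : E => edist x x₀ ^ 2 := by fun_prop
  refine (transportCost_le (fun p => edist p.1 p.2 ^ 2) (π := μ.prod ν)
    (by simp) (by simp)).trans ?_
  calc ∫⁻ p, edist p.1 p.2 ^ 2 ∂(μ.prod ν)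
      ≤ ∫⁻ p, 2 * (edist p.1 x₀ ^ 2 + edist p.2 x₀ ^ 2) ∂(μ.prod ν) := by
        refine lintegral_mono fun p => ?_
        calc edist p.1 p.2 ^ 2 ≤ (edist p.1 x₀ + edist p.2 x₀) ^ 2 := by
              gcongr
              exact edist_triangle_right _ _ _
          _ ≤ 2 * (edist p.1 x₀ ^ 2 + edist p.2 x₀ ^ 2) := by
              rw [edist_nndist, edist_nndist]
              exact_mod_cast add_sq_le (a := nndist p.1 x₀) (b := nndist p.2 x₀)
    _ = 2 * (∫⁻ x, edist x x₀ ^ 2 ∂μ + ∫⁻ x, edist x x₀ ^ 2 ∂ν) := by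
        rw [lintegral_const_mul _ (by fun_prop), lintegral_add_left (by fun_prop),
          ← lintegral_map (μ := μ.prod ν) hm measurable_fst,
          ← lintegral_map (μ := μ.prod ν) hm measurable_snd]
        simp

theorem stmt_5
    (U : Type*) [TopologicalSpace U] [PolishSpace U] [MeasurableSpace U] [BorelSpace U]
    (m : Measure U) [IsProbabilityMeasure m]
    (E : Type*) [MetricSpace E] [CompleteSpace E] [TopologicalSpace.SeparableSpace E]
    [MeasurableSpace E] [BorelSpace E] (x₀ : E)
    (μ ν : U → Measure E)
    (hμprob : ∀ u, IsProbabilityMeasure (μ u))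
    (hνprob : ∀ u, IsProbabilityMeasure (ν u))
    (hμmeas : ∀ B : Set E, MeasurableSet B → Measurable fun u => μ u B)
    (hνmeas : ∀ B : Set E, MeasurableSet B → Measurable fun u => ν u B)
    (hμ2 : ∫⁻ u, ∫⁻ x, edist x x₀ ^ 2 ∂(μ u) ∂m < ⊤)
    (hν2 : ∫⁻ u, ∫⁻ x, edist x x₀ ^ 2 ∂(ν u) ∂m < ⊤) :
    Measurable (fun u => W2sq (μ u) (ν u)) ∧
    ∫⁻ u, W2sq (μ u) (ν u) ∂m < ⊤ := by
  have : SecondCountableTopology E := UniformSpace.secondCountable_of_separable E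
  have : Nonempty E := ⟨x₀⟩
  let κ : Kernel U E := ⟨μ, Measure.measurable_of_measurable_coe μ hμmeas⟩
  let ξ : Kernel U E := ⟨ν, Measure.measurable_of_measurable_coe ν hνmeas⟩
  have : IsMarkovKernel κ := ⟨hμprob⟩
  have : IsMarkovKernel ξ := ⟨hνprob⟩
  refine ⟨?_, ?_⟩
  · simp_rw [W2sq_eq_iSup_transportCost]
    exact Measurable.iSup fun N => measurable_transportCost_truncCost N κ ξ
  · have hm : Measurable fun x : E => edist x x₀ ^ 2 := by fun_prop
    refine (lintegral_mono fun u => W2sq_le_second_moments x₀ (μ u) (ν u)).trans_lt ?_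
    have hκ : Measurable fun u => ∫⁻ x, edist x x₀ ^ 2 ∂(μ u) := hm.lintegral_kernel (κ := κ)
    rw [lintegral_const_mul' _ _ ENNReal.ofNat_ne_top, lintegral_add_left hκ]
    exact ENNReal.mul_lt_top ENNReal.ofNat_lt_top (ENNReal.add_lt_top.2 ⟨hμ2, hν2⟩)
end
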